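/- Let k ≥ 0 and let p : ℝ³ → ℝ³ be a vector field whose components are homogeneous polynomials of degree k. If ∇·p(x) = 0 for all x in the open unit ball and the Kelvin transform p*(x) := |x|^{−(2k+1)} p(x) satisfies ∇·p*(x) = 0 for all x with |x| > 1, then ∇·p = 0 on all of ℝ³ and x·p(x) = 0 for every x ∈ ℝ³. -/

import Mathlib

noncomputable section

open scoped BigOperators

/-- Points of `ℝ³`. -/
abbrev V3 : Type := Fin 3 → ℝ

/-- The Euclidean inner product on `ℝ³`. -/
def dot3 (x y : V3) : ℝ := ∑ i, x i * y i

/-- The Euclidean norm on `ℝ³`. -/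
def norm3 (x : V3) : ℝ := Real.sqrt (dot3 x x)

/-- The cross product on `ℝ³` (cyclic formula, `(x × y) i = x (i+1) y (i+2) - x (i+2) y (i+1)`). -/
def cross3 (x y : V3) : V3 := fun i => x (i + 1) * y (i + 2) - x (i + 2) * y (i + 1)

/-- Partial derivative in the `i`-th coordinate direction. -/
def pd (i : Fin 3) (f : V3 → ℝ) (x : V3) : ℝ := fderiv ℝ f x (Pi.single i 1)

/-- Gradient of a scalar field. -/
def grad3 (f : V3 → ℝ) (x : V3) : V3 := fun i => pd i f x

/-- Divergence of a vector field. -/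
def div3 (p : V3 → V3) (x : V3) : ℝ := ∑ i, pd i (fun y => p y i) x

/-- Curl of a vector field. -/
def curl3 (p : V3 → V3) (x : V3) : V3 :=
  fun i => pd (i + 1) (fun y => p y (i + 2)) x - pd (i + 2) (fun y => p y (i + 1)) x

/-- `f` is the function of a homogeneous polynomial of degree `k` on `ℝ³`. -/
def IsHomogPoly (k : ℕ) (f : V3 → ℝ) : Prop :=
  ∃ q : MvPolynomial (Fin 3) ℝ, q.IsHomogeneous k ∧ ∀ x, f x = MvPolynomial.eval x q

/-- `f` is harmonic (its Laplacian vanishes) on all of `ℝ³`. -/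
def IsHarmonic (f : V3 → ℝ) : Prop := ∀ x, ∑ i, pd i (pd i f) x = 0

/-- `P_k`: homogeneous harmonic polynomials of degree `k` (as functions on `ℝ³`). -/
def Pk (k : ℕ) : Set (V3 → ℝ) := {f | IsHomogPoly k f ∧ IsHarmonic f}

/-- `P_k³`: vector fields all of whose components lie in `P_k`. -/
def Pk3 (k : ℕ) : Set (V3 → V3) := {p | ∀ i, (fun x => p x i) ∈ Pk k}

/-- Kelvin transform of a degree-`k` homogeneous field: `p*(x) = |x|^{-(2k+1)} p(x)`. -/
def kelvin (k : ℕ) (p : V3 → V3) : V3 → V3 := fun x => (norm3 x ^ (2 * k + 1))⁻¹ • p x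

/-- `W_k^o`: fields in `P_k³` that are divergence free on `ℝ³` and whose Kelvin transform
is divergence free on `ℝ³ \ {0}`. -/
def Wko (k : ℕ) : Set (V3 → V3) :=
  {p | p ∈ Pk3 k ∧ (∀ x, div3 p x = 0) ∧ ∀ x : V3, x ≠ 0 → div3 (kelvin k p) x = 0}

/-- `W_k^-`: fields in `P_k³` that are divergence free and curl free on `ℝ³`. -/
def Wkm (k : ℕ) : Set (V3 → V3) :=
  {p | p ∈ Pk3 k ∧ (∀ x, div3 p x = 0) ∧ ∀ x, curl3 p x = 0}

/-- `W_k^+`: fields in `P_k³` whose Kelvin transform is divergence free and curl free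
on `ℝ³ \ {0}`. -/
def Wkp (k : ℕ) : Set (V3 → V3) :=
  {p | p ∈ Pk3 k ∧ (∀ x : V3, x ≠ 0 → div3 (kelvin k p) x = 0) ∧
    ∀ x : V3, x ≠ 0 → curl3 (kelvin k p) x = 0}

theorem IsHomogPoly.differentiable {k : ℕ} {f : V3 → ℝ} (hf : IsHomogPoly k f) :
    Differentiable ℝ f := by
  obtain ⟨q, -, hq⟩ := hf
  rw [show f = fun x => MvPolynomial.eval x q from funext hq]
  clear hq
  induction q using MvPolynomial.induction_on with
  | C a => simp
  | add p q hp hq => simpa using hp.fun_add hq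
  | mul_X p i hp => simpa using hp.fun_mul (differentiable_apply i)

theorem IsHomogPoly.apply_smul {k : ℕ} {f : V3 → ℝ} (hf : IsHomogPoly k f) (t : ℝ) (x : V3) :
    f (t • x) = t ^ k * f x := by
  obtain ⟨q, hk, hq⟩ := hf
  rw [hq, hq, MvPolynomial.eval_eq, MvPolynomial.eval_eq, Finset.mul_sum]
  refine Finset.sum_congr rfl fun d hd => ?_
  have hdeg := hk.degree_eq_sum_deg_support hd
  simp only [Pi.smul_apply, smul_eq_mul, mul_pow, Finset.prod_mul_distrib,
    Finset.prod_pow_eq_pow_sum]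
  rw [← hdeg]
  ring

theorem norm3_smul {t : ℝ} (ht : 0 ≤ t) (x : V3) : norm3 (t • x) = t * norm3 x := by
  have h : dot3 (t • x) (t • x) = t ^ 2 * dot3 x x := by
    simp only [dot3, Pi.smul_apply, smul_eq_mul, Finset.mul_sum]
    exact Finset.sum_congr rfl fun i _ => by ring
  rw [norm3, norm3, h, Real.sqrt_mul (sq_nonneg t), Real.sqrt_sq ht]

theorem dot3_self_pos {x : V3} (hx : x ≠ 0) : 0 < dot3 x x := by
  obtain ⟨i, hi⟩ := Function.ne_iff.mp hx
  exact Finset.sum_pos' (fun j _ => mul_self_nonneg _)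
    ⟨i, Finset.mem_univ i, mul_self_pos.mpr hi⟩

theorem pd_smul {k : ℕ} {f : V3 → ℝ} (hf : IsHomogPoly k f) (i : Fin 3) (t : ℝ) (x : V3) :
    t * pd i f (t • x) = t ^ k * pd i f x := by
  have h₁ : HasFDerivAt (fun y => f (t • y))
      ((fderiv ℝ f (t • x)).comp (t • ContinuousLinearMap.id ℝ V3)) x :=
    (hf.differentiable (t • x)).hasFDerivAt.comp x ((hasFDerivAt_id x).const_smul t)
  have h₂ : HasFDerivAt (fun y => f (t • y)) (t ^ k • fderiv ℝ f x) x := by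
    rw [show (fun y => f (t • y)) = fun y => t ^ k * f y from funext (hf.apply_smul t)]
    exact (hf.differentiable x).hasFDerivAt.const_mul (t ^ k)
  simpa [pd] using congrArg (fun L => L (Pi.single i 1)) (h₁.unique h₂)

theorem div3_smul {k : ℕ} {p : V3 → V3} (hp : ∀ i, IsHomogPoly k (fun x => p x i))
    (t : ℝ) (x : V3) : t * div3 p (t • x) = t ^ k * div3 p x := by
  simp only [div3, Finset.mul_sum, pd_smul (hp _)]

theorem hasFDerivAt_dot3_self (x : V3) :
    HasFDerivAt (fun y : V3 => dot3 y y)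
      (∑ i, (2 * x i) • (ContinuousLinearMap.proj i : V3 →L[ℝ] ℝ)) x := by
  refine HasFDerivAt.fun_sum fun i _ => ?_
  have h := (hasFDerivAt_apply (𝕜 := ℝ) (F' := fun _ : Fin 3 => ℝ) i x).fun_mul
    (hasFDerivAt_apply (𝕜 := ℝ) i x)
  rwa [← add_smul, ← two_mul] at h

theorem exists_hasDerivAt_inv_sqrt_pow (k : ℕ) {s : ℝ} (hs : 0 < s) :
    ∃ c ≠ 0, HasDerivAt (fun r => (Real.sqrt r ^ (2 * k + 1))⁻¹) c s := by
  have hr : 0 < Real.sqrt s := Real.sqrt_pos.mpr hs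
  refine ⟨_, ?_, (((Real.hasDerivAt_sqrt hs.ne').pow (2 * k + 1)).inv (pow_pos hr _).ne')⟩
  simp only [Pi.pow_apply]
  refine div_ne_zero (neg_ne_zero.mpr ?_) (by positivity)
  positivity

theorem exists_div3_kelvin (k : ℕ) {p : V3 → V3} {x : V3} (hx : x ≠ 0)
    (hp : ∀ i, DifferentiableAt ℝ (fun y => p y i) x) :
    ∃ c ≠ 0, div3 (kelvin k p) x
      = (norm3 x ^ (2 * k + 1))⁻¹ * div3 p x + c * dot3 x (p x) := by
  obtain ⟨c, hc, h⟩ := exists_hasDerivAt_inv_sqrt_pow k (dot3_self_pos hx)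
  have hw := h.comp_hasFDerivAt (f := fun y : V3 => dot3 y y) x (hasFDerivAt_dot3_self x)
  refine ⟨2 * c, mul_ne_zero two_ne_zero hc, ?_⟩
  have key (i : Fin 3) : pd i (fun y => kelvin k p y i) x
      = (norm3 x ^ (2 * k + 1))⁻¹ * pd i (fun y => p y i) x + 2 * c * (x i * p x i) := by
    have hm : HasFDerivAt (fun y => kelvin k p y i) _ x := hw.mul (hp i).hasFDerivAt
    rw [pd, hm.fderiv]
    simp [pd, norm3, Pi.single_apply]
    ring
  simp only [div3, dot3, key, Finset.sum_add_distrib, Finset.mul_sum]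

/-- If `p` has homogeneous polynomial components of degree `k`, `∇·p = 0` on
the open unit ball and `∇·p* = 0` for `|x| > 1`, then `∇·p = 0` on all of `ℝ³` and
`x·p(x) = 0` for every `x`. -/
theorem div_free_inside_outside (k : ℕ) (p : V3 → V3)
    (hp : ∀ i, IsHomogPoly k (fun x => p x i))
    (hin : ∀ x : V3, norm3 x < 1 → div3 p x = 0)
    (hout : ∀ x : V3, 1 < norm3 x → div3 (kelvin k p) x = 0) :
    (∀ x, div3 p x = 0) ∧ ∀ x, dot3 x (p x) = 0 := by
  have hdiv (x : V3) : div3 p x = 0 := by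
    have hn : 0 ≤ norm3 x := Real.sqrt_nonneg _
    have ht : 0 < (norm3 x + 1)⁻¹ := by positivity
    have h := div3_smul hp (norm3 x + 1)⁻¹ x
    rw [hin _ (by rw [norm3_smul ht.le, inv_mul_lt_one₀ (by positivity)]; linarith), mul_zero] at h
    exact (mul_eq_zero.mp h.symm).resolve_left (pow_pos ht k).ne'
  refine ⟨hdiv, fun x => ?_⟩
  rcases eq_or_ne x 0 with rfl | hx
  · simp [dot3]
  have hn : 0 < norm3 x := Real.sqrt_pos.mpr (dot3_self_pos hx)
  have ht : 0 < 2 * (norm3 x)⁻¹ := by positivity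
  set t := 2 * (norm3 x)⁻¹ with ht_def
  obtain ⟨c, hc, h⟩ := exists_div3_kelvin k (smul_ne_zero ht.ne' hx)
    fun i => (hp i).differentiable (t • x)
  have hlarge : 1 < norm3 (t • x) := by
    rw [norm3_smul ht.le, ht_def, inv_mul_cancel_right₀ hn.ne']
    norm_num
  rw [hout _ hlarge, hdiv, mul_zero, zero_add] at h
  have h0 := (mul_eq_zero.mp h.symm).resolve_left hc
  have hs : dot3 (t • x) (p (t • x)) = t ^ (k + 1) * dot3 x (p x) := by
    simp only [dot3, Finset.mul_sum, (hp _).apply_smul, Pi.smul_apply, smul_eq_mul]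
    exact Finset.sum_congr rfl fun i _ => by ring
  rw [hs] at h0
  exact (mul_eq_zero.mp h0).resolve_left (pow_pos ht _).ne'
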